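/- arXiv:1601.00823 — 2 statements merged into one kernel-verified Lean document; each statement's English description precedes it below -/
import Mathlib

section
/- Let K be a field, let p_1, …, p_m ∈ K[s] be pairwise distinct monic irreducible polynomials, and for each μ let T_{p_μ} be a strictly proper q×t matrix over K(s) each of whose entries can be written as a quotient of a polynomial by a power of p_μ. Suppose (F_μ, G_μ, H_μ) is a minimal realization of T_{p_μ} for each μ. Then the direct sum (F, G, H) with F = diag(F_1, …, F_m), G the vertical stack of G_1, …, G_m, and H = (H_1, …, H_m) is a minimal realization of T = T_{p_1} + ⋯ + T_{p_m}. -/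
open Polynomial Matrix Kronecker

set_option synthInstance.maxHeartbeats 1000000
set_option maxHeartbeats 1000000

noncomputable section

variable {K : Type*} [Field K]

/-- The strictly proper part of a rational function. -/
def piMinus (f : RatFunc K) : RatFunc K :=
  f - algebraMap (Polynomial K) (RatFunc K) (f.num /ₘ f.denom)

/-- A rational function is strictly proper. -/
def IsStrictlyProper (f : RatFunc K) : Prop :=
  f.num.degree < f.denom.degree

/-- Companion matrix of a polynomial, for size `n`. -/
def companion (n : ℕ) (p : Polynomial K) : Matrix (Fin n) (Fin n) K :=
  Matrix.of fun i j =>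
    if (i : ℕ) + 1 = (j : ℕ) then 1
    else if (i : ℕ) = n - 1 then -(p.coeff (j : ℕ)) else 0

/-- The Hankel matrix `M(p)`. -/
def hankelM (n : ℕ) (p : Polynomial K) : Matrix (Fin n) (Fin n) K :=
  Matrix.of fun i j =>
    if (i : ℕ) + (j : ℕ) + 1 ≤ n then p.coeff ((i : ℕ) + (j : ℕ) + 1) else 0

/-- The matrix `N_k` with ones on the superdiagonal. -/
def supN (R : Type*) [Semiring R] (k : ℕ) : Matrix (Fin k) (Fin k) R :=
  Matrix.of fun i j => if (i : ℕ) + 1 = (j : ℕ) then 1 else 0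

/-- `V = eₙ e₁ᵀ`. -/
def eV (K : Type*) [Field K] (n : ℕ) : Matrix (Fin n) (Fin n) K :=
  Matrix.of fun i j => if (i : ℕ) = n - 1 ∧ (j : ℕ) = 0 then 1 else 0

/-- Jacobson block `J(p^k)`, as an `nk × nk` matrix indexed by `Fin k × Fin n`. -/
def jacobson (n : ℕ) (p : Polynomial K) (k : ℕ) :
    Matrix (Fin k × Fin n) (Fin k × Fin n) K :=
  (1 : Matrix (Fin k) (Fin k) K) ⊗ₖ companion n p + supN K k ⊗ₖ eV K n

/-- `sI - F` as a matrix over `K(s)`. -/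
def sISub {ι : Type*} [Fintype ι] [DecidableEq ι] (F : Matrix ι ι K) :
    Matrix ι ι (RatFunc K) :=
  Matrix.diagonal (fun _ => (RatFunc.X : RatFunc K)) - F.map (algebraMap K (RatFunc K))

/-- `b(s) = (1, s, …, s^{n-1})ᵀ` as a vector over `K(s)`. -/
def bVec (K : Type*) [Field K] (n : ℕ) : Fin n → RatFunc K :=
  fun i => (RatFunc.X : RatFunc K) ^ (i : ℕ)

/-- The rank-one matrix `b(s) b(s)ᵀ`. -/
def bbT (K : Type*) [Field K] (n : ℕ) : Matrix (Fin n) (Fin n) (RatFunc K) :=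
  Matrix.of fun i j => bVec K n i * bVec K n j

section Resolvent

variable {ι κ : Type*} [Fintype ι] [DecidableEq ι] [Fintype κ] [DecidableEq κ]

lemma sISub_eq_map_charmatrix (F : Matrix ι ι K) :
    sISub F = (charmatrix F).map (algebraMap K[X] (RatFunc K)) := by
  ext i j
  by_cases h : i = j
  · subst h
    simp [sISub, charmatrix, RatFunc.algebraMap_eq_C]
  · simp [sISub, charmatrix, h, RatFunc.algebraMap_eq_C]

lemma isUnit_sISub (F : Matrix ι ι K) : IsUnit (sISub F) := by
  rw [Matrix.isUnit_iff_isUnit_det, isUnit_iff_ne_zero, sISub_eq_map_charmatrix,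
    ← RingHom.mapMatrix_apply, ← RingHom.map_det]
  exact RatFunc.algebraMap_ne_zero F.charpoly_monic.ne_zero

lemma sISub_eq_smul_sub (F : Matrix ι ι K) :
    sISub F = (RatFunc.X : RatFunc K) • (1 : Matrix ι ι (RatFunc K)) -
      F.map (algebraMap K (RatFunc K)) := by
  rw [sISub, smul_one_eq_diagonal]

lemma X_smul_inv_sISub (F : Matrix ι ι K) :
    (RatFunc.X : RatFunc K) • (sISub F)⁻¹ =
      1 + (sISub F)⁻¹ * F.map (algebraMap K (RatFunc K)) := by
  have h := Matrix.nonsing_inv_mul (sISub F) ((Matrix.isUnit_iff_isUnit_det _).1 (isUnit_sISub F))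
  nth_rewrite 2 [sISub_eq_smul_sub] at h
  rw [Matrix.mul_sub, Matrix.mul_smul, Matrix.mul_one] at h
  rw [← h]
  abel

/-- An intertwining relation between two matrices passes to their resolvents. -/
lemma mul_inv_sISub_of_intertwine {F : Matrix ι ι K} {F' : Matrix κ κ K} {A : Matrix ι κ K}
    (h : F * A = A * F') :
    A.map (algebraMap K (RatFunc K)) * (sISub F')⁻¹ =
      (sISub F)⁻¹ * A.map (algebraMap K (RatFunc K)) := by
  have h1 : sISub F * A.map (algebraMap K (RatFunc K)) =
      A.map (algebraMap K (RatFunc K)) * sISub F' := by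
    rw [sISub_eq_smul_sub, sISub_eq_smul_sub, Matrix.sub_mul, Matrix.mul_sub, ← Matrix.map_mul,
      ← Matrix.map_mul, h]
    simp
  have hF := Matrix.nonsing_inv_mul (sISub F)
    ((Matrix.isUnit_iff_isUnit_det _).1 (isUnit_sISub F))
  have hF' := Matrix.mul_nonsing_inv (sISub F')
    ((Matrix.isUnit_iff_isUnit_det _).1 (isUnit_sISub F'))
  calc A.map (algebraMap K (RatFunc K)) * (sISub F')⁻¹
      = (sISub F)⁻¹ * (sISub F * A.map (algebraMap K (RatFunc K))) * (sISub F')⁻¹ := by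
        rw [← Matrix.mul_assoc, hF, Matrix.one_mul]
    _ = (sISub F)⁻¹ * A.map (algebraMap K (RatFunc K)) := by
        rw [h1, Matrix.mul_assoc, Matrix.mul_assoc, hF', Matrix.mul_one]

/-- Multiplying the resolvent by `c(s)` or by `c(F)` agrees up to a polynomial matrix. -/
lemma exists_smul_inv_sISub_eq (F : Matrix ι ι K) (c : K[X]) :
    ∃ Q : Matrix ι ι K[X],
      algebraMap K[X] (RatFunc K) c • (sISub F)⁻¹ =
        (sISub F)⁻¹ * (aeval F c).map (algebraMap K (RatFunc K)) +
          Q.map (algebraMap K[X] (RatFunc K)) := by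
  induction c using Polynomial.induction_on' with
  | add c d hc hd =>
    obtain ⟨Q, hQ⟩ := hc
    obtain ⟨R, hR⟩ := hd
    refine ⟨Q + R, ?_⟩
    rw [map_add, map_add, add_smul, hQ, hR, Matrix.map_add _ (map_add _),
      Matrix.map_add _ (map_add _), Matrix.mul_add]
    abel
  | monomial n a =>
    induction n with
    | zero =>
      refine ⟨0, ?_⟩
      have h1 : (algebraMap K (Matrix ι ι K) a).map RatFunc.C =
          RatFunc.C a • (1 : Matrix ι ι (RatFunc K)) := by
        ext i j
        by_cases h : i = j
        · subst h
          simp [Matrix.algebraMap_matrix_apply]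
        · simp [Matrix.algebraMap_matrix_apply, h]
      simp [h1]
    | succ n ih =>
      obtain ⟨Q, hQ⟩ := ih
      refine ⟨(Polynomial.X : K[X]) • Q + (aeval F (monomial n a)).map C, ?_⟩
      have h1 : (monomial (n + 1) a : K[X]) = Polynomial.X * monomial n a := by
        rw [Polynomial.X_mul_monomial]
      have h2 (M : Matrix ι ι K) : (M.map (C : K →+* K[X])).map (algebraMap K[X] (RatFunc K)) =
          M.map (algebraMap K (RatFunc K)) := by
        ext i j
        simp [RatFunc.algebraMap_eq_C]
      have h3 : ((Polynomial.X : K[X]) • Q).map (algebraMap K[X] (RatFunc K)) =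
          (RatFunc.X : RatFunc K) • Q.map (algebraMap K[X] (RatFunc K)) := by
        ext i j
        simp
      rw [h1, map_mul, map_mul, mul_smul, hQ, Matrix.map_add _ (map_add _), h2, h3, smul_add,
        RatFunc.algebraMap_X, ← Matrix.smul_mul, X_smul_inv_sISub, Matrix.add_mul, Matrix.one_mul,
        aeval_X, Matrix.map_mul, Matrix.mul_assoc]
      abel

open Classical in
lemma inftyValuation_inv_sISub_lt_one (F : Matrix ι ι K) (i j : ι) :
    RatFunc.inftyValuation K ((sISub F)⁻¹ i j) < 1 := by
  set v := RatFunc.inftyValuation K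
  set Y := (sISub F)⁻¹
  have hC (k : K) : v (algebraMap K (RatFunc K) k) ≤ 1 := by
    by_cases hk : k = 0
    · simp [hk]
    · rw [RatFunc.algebraMap_eq_C, RatFunc.inftyValuation.C K hk]
  obtain ⟨j₀, -, hj₀⟩ := Finset.exists_max_image Finset.univ (fun l => v (Y i l)) ⟨j, by simp⟩
  refine (hj₀ j (by simp)).trans_lt ?_
  by_contra! h
  have hX : 1 < v RatFunc.X := by
    rw [RatFunc.inftyValuation.X, ← WithZero.exp_zero, WithZero.exp_lt_exp]
    exact zero_lt_one
  have h1 : v RatFunc.X * v (Y i j₀) ≤ v (Y i j₀) := by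
    have h2 := congrFun (congrFun (X_smul_inv_sISub F) i) j₀
    rw [Matrix.smul_apply, Matrix.add_apply, smul_eq_mul] at h2
    rw [← map_mul, h2]
    refine v.map_add_le ?_ ?_
    · refine le_trans ?_ h
      rw [Matrix.one_apply]
      split_ifs <;> simp
    · rw [Matrix.mul_apply]
      refine v.map_sum_le fun l _ => ?_
      rw [map_mul]
      exact (mul_le_mul' (hj₀ l (by simp)) (hC _)).trans (mul_one _).le
  have h3 : v (Y i j₀) < v RatFunc.X * v (Y i j₀) :=
    lt_mul_of_one_lt_left (zero_lt_one.trans_le h) hX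
  exact absurd h1 h3.not_ge

open Classical in
lemma inftyValuation_transfer_lt_one {α β : Type*} (F : Matrix ι ι K) (G : Matrix ι β K)
    (H : Matrix α ι K) (a : α) (b : β) :
    RatFunc.inftyValuation K ((H.map (algebraMap K (RatFunc K)) * (sISub F)⁻¹ *
      G.map (algebraMap K (RatFunc K))) a b) < 1 := by
  have hC (k : K) : RatFunc.inftyValuation K (algebraMap K (RatFunc K) k) ≤ 1 := by
    by_cases hk : k = 0
    · simp [hk]
    · rw [RatFunc.algebraMap_eq_C, RatFunc.inftyValuation.C K hk]
  rw [Matrix.mul_apply]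
  refine Valuation.map_sum_lt' _ zero_lt_one fun i _ => ?_
  rw [map_mul, Matrix.mul_apply]
  refine (mul_le_of_le_one_right' (hC _)).trans_lt ?_
  refine Valuation.map_sum_lt' _ zero_lt_one fun j _ => ?_
  rw [map_mul]
  exact (mul_le_of_le_one_left' (hC _)).trans_lt (inftyValuation_inv_sISub_lt_one F j i)

open Classical in
lemma eq_of_sub_eq_algebraMap {f g : RatFunc K} (hf : RatFunc.inftyValuation K f < 1)
    (hg : RatFunc.inftyValuation K g < 1) (r : K[X])
    (h : f - g = algebraMap K[X] (RatFunc K) r) : f = g := by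
  by_contra hne
  have hr : r ≠ 0 := by
    rintro rfl
    exact hne (sub_eq_zero.1 (by simpa using h))
  have h1 := (Valuation.map_sub _ f g).trans_lt (max_lt hf hg)
  rw [h, RatFunc.inftyValuation_apply, RatFunc.inftyValuation.polynomial K hr,
    ← WithZero.exp_zero, WithZero.exp_lt_exp] at h1
  lia

lemma inv_sISub_blockDiagonal' {o : Type*} [Fintype o] [DecidableEq o] {d : o → Type*}
    [∀ i, Fintype (d i)] [∀ i, DecidableEq (d i)] (F : ∀ i, Matrix (d i) (d i) K) :
    (sISub (Matrix.blockDiagonal' F))⁻¹ = Matrix.blockDiagonal' fun i => (sISub (F i))⁻¹ := by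
  have h1 : sISub (Matrix.blockDiagonal' F) = Matrix.blockDiagonal' fun i => sISub (F i) := by
    ext ⟨i, x⟩ ⟨j, y⟩
    by_cases h : i = j
    · subst h
      simp [sISub, Matrix.diagonal_apply]
    · simp [sISub, Matrix.blockDiagonal'_apply_ne, h]
  refine Matrix.inv_eq_right_inv ?_
  rw [h1, ← Matrix.blockDiagonal'_mul]
  simp_rw [Matrix.mul_nonsing_inv _ ((Matrix.isUnit_iff_isUnit_det _).1 (isUnit_sISub _))]
  exact Matrix.blockDiagonal'_one

end Resolvent

lemma isCoprime_of_monic_of_irreducible {p q : K[X]} (hp : p.Monic) (hq : q.Monic)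
    (hp' : Irreducible p) (hq' : Irreducible q) (hne : p ≠ q) : IsCoprime p q :=
  (hp'.isCoprime_or_dvd q).resolve_right fun h =>
    hne (eq_of_monic_of_associated hp hq (hp'.associated_of_dvd hq' h))

/-- Polynomials inducing, modulo `χ`, the projections onto the primary components. -/
lemma exists_primary_projections {o : Type*} [Fintype o] [DecidableEq o] (p : o → K[X])
    (hirr : ∀ i, Irreducible (p i)) (hcop : Pairwise fun i j => IsCoprime (p i) (p j))
    {χ : K[X]} (hχ : χ ≠ 0) (N : ℕ) :
    ∃ c : o → K[X], (∀ i, p i ^ N ∣ c i - 1) ∧ (∀ i j, i ≠ j → p j ^ N ∣ c i) ∧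
      (∀ i, χ ∣ c i * (c i - 1)) ∧ ∀ i j, i ≠ j → χ ∣ c i * c j := by
  have hmul (i) := (FiniteMultiplicity.of_not_isUnit (hirr i).not_isUnit
    hχ).exists_eq_pow_mul_and_not_dvd
  choose r hr hdvd using hmul
  set e : o → ℕ := fun i => multiplicity (p i) χ
  set M := N + ∑ i, e i
  have heM (i) : e i ≤ M :=
    (Finset.single_le_sum (fun _ _ => Nat.zero_le _) (Finset.mem_univ i)).trans
      (Nat.le_add_left _ _)
  have hbez (i) : IsCoprime (p i ^ M) (r i * ∏ j ∈ Finset.univ.erase i, p j ^ M) := by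
    refine IsCoprime.mul_right ?_ (IsCoprime.prod_right fun j hj => ?_)
    · exact (((hirr i).isCoprime_or_dvd _).resolve_right (hdvd i)).pow_left
    · exact (hcop (Finset.ne_of_mem_erase hj).symm).pow
  choose u w huw using hbez
  have h1 (i) : p i ^ M ∣ w i * (r i * ∏ j ∈ Finset.univ.erase i, p j ^ M) - 1 :=
    ⟨-u i, by linear_combination huw i⟩
  have h2 (i j) (hij : i ≠ j) : p j ^ M ∣ w i * (r i * ∏ j ∈ Finset.univ.erase i, p j ^ M) :=
    Dvd.dvd.mul_left (Dvd.dvd.mul_left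
      (Finset.dvd_prod_of_mem (fun j => p j ^ M) (by simp [hij.symm])) _) _
  have h3 (i) : r i ∣ w i * (r i * ∏ j ∈ Finset.univ.erase i, p j ^ M) :=
    Dvd.dvd.mul_left (dvd_mul_right _ _) _
  have h4 (i) (x y : K[X]) (hx : r i ∣ x) (hy : p i ^ M ∣ y) : χ ∣ x * y := by
    rw [hr i, mul_comm]
    exact mul_dvd_mul hx ((pow_dvd_pow _ (heM i)).trans hy)
  have h5 (i) : p i ^ N ∣ p i ^ M := pow_dvd_pow _ (Nat.le_add_right _ _)
  exact ⟨fun i => w i * (r i * ∏ j ∈ Finset.univ.erase i, p j ^ M), fun i => (h5 i).trans (h1 i),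
    fun i j hij => (h5 j).trans (h2 i j hij), fun i => h4 i _ _ (h3 i) (h1 i),
    fun i j hij => h4 i _ _ (h3 i) (h2 j i hij.symm)⟩

/-- The rank factorization of an idempotent matrix. -/
lemma exists_rank_factorization_of_idempotent {n : ℕ} (E : Matrix (Fin n) (Fin n) K)
    (hE : E * E = E) :
    ∃ (A : Matrix (Fin n) (Fin E.rank) K) (B : Matrix (Fin E.rank) (Fin n) K),
      A * B = E ∧ B * A = 1 := by
  let V := LinearMap.range E.toLin'
  have hk : E.rank = Module.finrank K V := by
    rw [Matrix.rank, ← Matrix.toLin'_apply']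
  let b : Module.Basis (Fin E.rank) K V := Module.finBasisOfFinrankEq K V hk.symm
  let s := Pi.basisFun K (Fin n)
  refine ⟨LinearMap.toMatrix b s V.subtype, LinearMap.toMatrix s b E.toLin'.rangeRestrict, ?_, ?_⟩
  · rw [← LinearMap.toMatrix_comp, LinearMap.subtype_comp_codRestrict]
    exact LinearMap.toMatrix'_toLin' E
  · rw [← LinearMap.toMatrix_comp]
    have : E.toLin'.rangeRestrict ∘ₗ V.subtype = LinearMap.id := by
      ext ⟨x, y, rfl⟩ : 1
      refine Subtype.ext ?_
      change E.toLin' (E.toLin' y) = E.toLin' y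
      rw [← LinearMap.comp_apply, ← Matrix.toLin'_mul, hE]
    rw [this, LinearMap.toMatrix_id]

lemma sum_rank_le_of_orthogonal_idempotents {o : Type*} [Fintype o] [DecidableEq o] {n : ℕ}
    (E : o → Matrix (Fin n) (Fin n) K) (hE : ∀ i, E i * E i = E i)
    (horth : ∀ i j, i ≠ j → E i * E j = 0) : ∑ i, (E i).rank ≤ n := by
  let φ : (Fin n → K) →ₗ[K] ∀ i, LinearMap.range (E i).mulVecLin :=
    LinearMap.pi fun i => (E i).mulVecLin.rangeRestrict
  have hφ : Function.Surjective φ := by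
    intro w
    refine ⟨∑ i, (w i : Fin n → K), funext fun i => Subtype.ext ?_⟩
    change (E i).mulVecLin (∑ j, (w j : Fin n → K)) = w i
    rw [map_sum, Finset.sum_eq_single i]
    · obtain ⟨y, hy⟩ := (w i).2
      rw [← hy, Matrix.mulVecLin_apply, Matrix.mulVecLin_apply, Matrix.mulVec_mulVec, hE]
    · intro j _ hj
      obtain ⟨y, hy⟩ := (w j).2
      rw [← hy, Matrix.mulVecLin_apply, Matrix.mulVecLin_apply, Matrix.mulVec_mulVec,
        horth i j hj.symm, Matrix.zero_mulVec]
    · simp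
  have h := LinearMap.finrank_le_finrank_of_surjective hφ
  rwa [Module.finrank_pi_fintype, Module.finrank_fin_fun] at h

/-- Multiplying by a polynomial divisible by `p ^ N` clears a denominator dividing `p ^ N`. -/
lemma exists_algebraMap_mul_div_eq {p c : K[X]} (hp : p ≠ 0) {e N : ℕ} (heN : e ≤ N)
    (hc : p ^ N ∣ c) (f : K[X]) :
    ∃ g : K[X], algebraMap K[X] (RatFunc K) c *
      (algebraMap K[X] (RatFunc K) f / algebraMap K[X] (RatFunc K) p ^ e) =
        algebraMap K[X] (RatFunc K) g := by
  obtain ⟨x, rfl⟩ := (pow_dvd_pow p heN).trans hc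
  have := RatFunc.algebraMap_ne_zero hp
  refine ⟨x * f, ?_⟩
  rw [map_mul, map_mul, map_pow]
  field_simp

/-- Compressing a realization along an idempotent `c(F) = A * B`, the new transfer matrix agrees
with `c(s)` times the old one up to a polynomial matrix. -/
lemma exists_smul_transfer_eq {q t n k : ℕ} (F : Matrix (Fin n) (Fin n) K)
    (G : Matrix (Fin n) (Fin t) K) (H : Matrix (Fin q) (Fin n) K) (c : K[X])
    (A : Matrix (Fin n) (Fin k) K) (B : Matrix (Fin k) (Fin n) K)
    (hAB : A * B = aeval F c) (hBA : B * A = 1) :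
    ∃ Q : Matrix (Fin q) (Fin t) K[X],
      algebraMap K[X] (RatFunc K) c • (H.map (algebraMap K (RatFunc K)) * (sISub F)⁻¹ *
        G.map (algebraMap K (RatFunc K))) =
      (H * A).map (algebraMap K (RatFunc K)) * (sISub (B * F * A))⁻¹ *
        (B * G).map (algebraMap K (RatFunc K)) + Q.map (algebraMap K[X] (RatFunc K)) := by
  obtain ⟨Q, hQ⟩ := exists_smul_inv_sISub_eq F c
  have hcomm : F * aeval F c = aeval F c * F := by
    have h : aeval F (Polynomial.X * c) = aeval F (c * Polynomial.X) := by rw [mul_comm]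
    simpa only [map_mul, aeval_X] using h
  have hint : F * A = A * (B * F * A) := by
    rw [← Matrix.mul_assoc, ← Matrix.mul_assoc, hAB, ← hcomm, ← hAB, Matrix.mul_assoc,
      Matrix.mul_assoc, hBA, Matrix.mul_one]
  have hpoly :
      H.map (algebraMap K (RatFunc K)) * Q.map (algebraMap K[X] (RatFunc K)) *
        G.map (algebraMap K (RatFunc K)) =
      (H.map C * Q * G.map C).map (algebraMap K[X] (RatFunc K)) := by
    rw [Matrix.map_mul, Matrix.map_mul, Matrix.map_map, Matrix.map_map]
    rfl
  refine ⟨H.map C * Q * G.map C, ?_⟩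
  rw [← hpoly, ← Matrix.smul_mul, ← Matrix.mul_smul, hQ, Matrix.mul_add, Matrix.add_mul,
    ← hAB, Matrix.map_mul, Matrix.map_mul, Matrix.map_mul, Matrix.mul_assoc (H.map _) (A.map _),
    mul_inv_sISub_of_intertwine hint]
  simp only [Matrix.mul_assoc]

/-- a direct sum of minimal realizations of strictly proper matrices
`T_{p_μ}` (with denominators powers of pairwise distinct monic irreducible `p_μ`)
is a minimal realization of `T = Σ_μ T_{p_μ}`. -/
theorem direct_sum_minimal_realization (q t m : ℕ) (p : Fin m → Polynomial K)
    (hmonic : ∀ μ, (p μ).Monic) (hirr : ∀ μ, Irreducible (p μ))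
    (hdist : Function.Injective p)
    (T : Fin m → Matrix (Fin q) (Fin t) (RatFunc K))
    (hsp : ∀ μ a b, IsStrictlyProper (T μ a b))
    (hform : ∀ μ a b, ∃ (f : Polynomial K) (e : ℕ),
      T μ a b = algebraMap (Polynomial K) (RatFunc K) f /
        (algebraMap (Polynomial K) (RatFunc K) (p μ)) ^ e)
    (d : Fin m → ℕ)
    (F : ∀ μ, Matrix (Fin (d μ)) (Fin (d μ)) K)
    (G : ∀ μ, Matrix (Fin (d μ)) (Fin t) K)
    (H : ∀ μ, Matrix (Fin q) (Fin (d μ)) K)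
    (hreal : ∀ μ, (H μ).map (algebraMap K (RatFunc K)) * (sISub (F μ))⁻¹ *
      (G μ).map (algebraMap K (RatFunc K)) = T μ)
    (hmin : ∀ μ (m' : ℕ) (F' : Matrix (Fin m') (Fin m') K)
      (G' : Matrix (Fin m') (Fin t) K) (H' : Matrix (Fin q) (Fin m') K),
      H'.map (algebraMap K (RatFunc K)) * (sISub F')⁻¹ *
        G'.map (algebraMap K (RatFunc K)) = T μ → d μ ≤ m') :
    ((Matrix.of fun (a : Fin q) (x : Σ μ : Fin m, Fin (d μ)) => H x.1 a x.2).map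
        (algebraMap K (RatFunc K)) *
      (sISub (Matrix.blockDiagonal' F))⁻¹ *
      (Matrix.of fun (x : Σ μ : Fin m, Fin (d μ)) (b : Fin t) => G x.1 x.2 b).map
        (algebraMap K (RatFunc K)) = ∑ μ, T μ) ∧
    ∀ (m' : ℕ) (F' : Matrix (Fin m') (Fin m') K) (G' : Matrix (Fin m') (Fin t) K)
      (H' : Matrix (Fin q) (Fin m') K),
      H'.map (algebraMap K (RatFunc K)) * (sISub F')⁻¹ *
        G'.map (algebraMap K (RatFunc K)) = ∑ μ, T μ →
      (∑ μ, d μ) ≤ m' := by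
  constructor
  · rw [inv_sISub_blockDiagonal']
    ext a b
    rw [Matrix.sum_apply, Matrix.mul_apply, Fintype.sum_sigma]
    refine Finset.sum_congr rfl fun μ _ => ?_
    rw [← hreal μ, Matrix.mul_apply]
    refine Finset.sum_congr rfl fun x _ => ?_
    congr 1
    rw [Matrix.mul_apply, Matrix.mul_apply, Fintype.sum_sigma, Finset.sum_eq_single μ]
    · simp
    · intro ν _ hν
      exact Finset.sum_eq_zero fun y _ => by rw [Matrix.blockDiagonal'_apply_ne _ _ _ hν, mul_zero]
    · simp
  · intro m' F' G' H' hreal'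
    classical
    choose f e hfe using hform
    set N := ∑ μ, ∑ a, ∑ b, e μ a b
    have heN (μ a b) : e μ a b ≤ N :=
      (Finset.single_le_sum (f := fun b => e μ a b) (fun _ _ => Nat.zero_le _)
        (Finset.mem_univ b)).trans <|
      (Finset.single_le_sum (f := fun a => ∑ b, e μ a b) (fun _ _ => Nat.zero_le _)
        (Finset.mem_univ a)).trans <|
      Finset.single_le_sum (f := fun μ => ∑ a, ∑ b, e μ a b) (fun _ _ => Nat.zero_le _)
        (Finset.mem_univ μ)
    have hcop : Pairwise fun μ ν => IsCoprime (p μ) (p ν) := fun μ ν hne =>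
      isCoprime_of_monic_of_irreducible (hmonic μ) (hmonic ν) (hirr μ) (hirr ν) (hdist.ne hne)
    obtain ⟨c, hc1, hc0, hidem, horth⟩ :=
      exists_primary_projections p hirr hcop F'.charpoly_monic.ne_zero N
    have hann {x : K[X]} (hx : F'.charpoly ∣ x) : aeval F' x = 0 := by
      obtain ⟨y, rfl⟩ := hx
      rw [map_mul, Matrix.aeval_self_charpoly, zero_mul]
    have hE (μ) : aeval F' (c μ) * aeval F' (c μ) = aeval F' (c μ) := by
      have h := hann (hidem μ)
      rwa [mul_sub, mul_one, map_sub, map_mul, sub_eq_zero] at h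
    refine le_trans (Finset.sum_le_sum fun μ _ => ?_)
      (sum_rank_le_of_orthogonal_idempotents (fun μ => aeval F' (c μ)) hE
        fun μ ν hne => by rw [← map_mul, hann (horth μ ν hne)])
    obtain ⟨A, B, hAB, hBA⟩ := exists_rank_factorization_of_idempotent _ (hE μ)
    obtain ⟨Q, hQ⟩ := exists_smul_transfer_eq F' G' H' (c μ) A B hAB hBA
    refine hmin μ _ (B * F' * A) (B * G') (H' * A) ?_
    have hother (a b) (ν) : ∃ g : K[X],
        algebraMap K[X] (RatFunc K) (c μ - if ν = μ then 1 else 0) * T ν a b =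
          algebraMap K[X] (RatFunc K) g := by
      rw [hfe]
      refine exists_algebraMap_mul_div_eq (hirr ν).ne_zero (heN ν a b) ?_ _
      split_ifs with h
      · exact h ▸ hc1 μ
      · simpa using hc0 μ ν (Ne.symm h)
    choose g hg using hother
    ext a b
    refine eq_of_sub_eq_algebraMap (inftyValuation_transfer_lt_one _ _ _ a b)
      (hreal μ ▸ inftyValuation_transfer_lt_one (F μ) (G μ) (H μ) a b)
      (∑ ν, g a b ν - Q a b) ?_
    have h1 := congrFun (congrFun hQ a) b
    rw [hreal', Matrix.smul_apply, Matrix.sum_apply, Matrix.add_apply, Matrix.map_apply,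
      smul_eq_mul] at h1
    have h2 : ∑ ν, algebraMap K[X] (RatFunc K) (g a b ν) =
        algebraMap K[X] (RatFunc K) (c μ) * ∑ ν, T ν a b - T μ a b := by
      simp_rw [← hg, map_sub, sub_mul, Finset.sum_sub_distrib, ← Finset.mul_sum]
      simp [apply_ite, ite_mul]
    rw [map_sub, map_sum, h2, h1]
    ring


end
end

section
/- Let K be a field and let A, F, G, H ∈ K^{ℓ×ℓ} be such that H (sI − F)^{−1} G = (sI − A)^{−1} as matrices over K(s). Then H is invertible with G = H^{−1}, and A = H F H^{−1}; in particular F is similar to A. -/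
open Polynomial Matrix Kronecker

set_option synthInstance.maxHeartbeats 1000000
set_option maxHeartbeats 1000000

noncomputable section

variable {K : Type*} [Field K]

theorem sISub_eq_charmatrix_map {ι : Type*} [Fintype ι] [DecidableEq ι] (F : Matrix ι ι K) :
    sISub F = F.charmatrix.map (algebraMap K[X] (RatFunc K)) := by
  ext i j
  by_cases h : i = j
  · subst h
    simp [sISub, charmatrix, RatFunc.algebraMap_eq_C]
  · simp [sISub, charmatrix, h, RatFunc.algebraMap_eq_C]

theorem isUnit_det_sISub {ι : Type*} [Fintype ι] [DecidableEq ι] (F : Matrix ι ι K) :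
    IsUnit (sISub F).det := by
  have h : (sISub F).det = algebraMap K[X] (RatFunc K) F.charpoly := by
    rw [sISub_eq_charmatrix_map, charpoly, RingHom.map_det]
    rfl
  rw [h, isUnit_iff_ne_zero]
  exact RatFunc.algebraMap_ne_zero F.charpoly_monic.ne_zero

/-- Comparison of coefficients of polynomials of degree at most one, inside `K(s)`. -/
theorem RatFunc.eq_and_eq_of_X_mul_sub {a b c d : K}
    (h : (RatFunc.X : RatFunc K) * algebraMap K (RatFunc K) a - algebraMap K (RatFunc K) b =
      RatFunc.X * algebraMap K (RatFunc K) c - algebraMap K (RatFunc K) d) :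
    a = c ∧ b = d := by
  have hp : (Polynomial.X * Polynomial.C a - Polynomial.C b : K[X]) =
      Polynomial.X * Polynomial.C c - Polynomial.C d := by
    apply RatFunc.algebraMap_injective K
    simpa only [map_sub, map_mul, RatFunc.algebraMap_X, RatFunc.algebraMap_C,
      RatFunc.algebraMap_eq_C] using h
  have h₀ := congrArg (fun p => p.coeff 0) hp
  have h₁ := congrArg (fun p => p.coeff 1) hp
  simp [Polynomial.coeff_C] at h₀ h₁
  exact ⟨h₁, h₀⟩

theorem sISub_eq_smul_one_sub {ι : Type*} [Fintype ι] [DecidableEq ι] (F : Matrix ι ι K) :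
    sISub F = (RatFunc.X : RatFunc K) • (1 : Matrix ι ι K).map (algebraMap K (RatFunc K)) -
      F.map (algebraMap K (RatFunc K)) := by
  rw [Matrix.map_one _ (map_zero _) (map_one _), smul_one_eq_diagonal]
  rfl

/-- if `H (sI - F)⁻¹ G = (sI - A)⁻¹` over `K(s)`, then `H` is
invertible, `G = H⁻¹`, and `A = H F H⁻¹`; in particular `F` is similar to `A`. -/
theorem resolvent_realization_gives_similarity (l : ℕ)
    (A F G H : Matrix (Fin l) (Fin l) K)
    (hreal : H.map (algebraMap K (RatFunc K)) * (sISub F)⁻¹ *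
      G.map (algebraMap K (RatFunc K)) = (sISub A)⁻¹) :
    IsUnit H.det ∧ G = H⁻¹ ∧ A = H * F * H⁻¹ := by
  have hA := isUnit_det_sISub A
  have hF := isUnit_det_sISub F
  have h₁ : G.map (algebraMap K (RatFunc K)) * sISub A * H.map (algebraMap K (RatFunc K)) *
      (sISub F)⁻¹ = 1 := by
    have h := mul_nonsing_inv _ hA
    rw [← hreal, ← Matrix.mul_assoc, _root_.mul_eq_one_comm] at h
    simpa only [Matrix.mul_assoc] using h
  have h₂ : G.map (algebraMap K (RatFunc K)) * sISub A * H.map (algebraMap K (RatFunc K)) =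
      sISub F := by
    rw [← nonsing_inv_mul_cancel_right (sISub F)
      (G.map (algebraMap K (RatFunc K)) * sISub A * H.map (algebraMap K (RatFunc K))) hF,
      h₁, Matrix.one_mul]
  rw [sISub_eq_smul_one_sub A, sISub_eq_smul_one_sub F, Matrix.mul_sub, Matrix.sub_mul,
    Matrix.mul_smul, Matrix.smul_mul, ← Matrix.map_mul, ← Matrix.map_mul, ← Matrix.map_mul,
    ← Matrix.map_mul, Matrix.mul_one] at h₂
  have h₃ (i j) := RatFunc.eq_and_eq_of_X_mul_sub (congrFun (congrFun h₂ i) j)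
  have hGH : G * H = 1 := Matrix.ext fun i j => (h₃ i j).1
  have hGAH : G * A * H = F := Matrix.ext fun i j => (h₃ i j).2
  have hHG : H * G = 1 := _root_.mul_eq_one_comm.mp hGH
  have hG : G = H⁻¹ := (inv_eq_left_inv hGH).symm
  refine ⟨isUnit_det_of_left_inverse hGH, hG, ?_⟩
  rw [← hG, ← hGAH]
  calc A = (H * G) * A * (H * G) := by rw [hHG, Matrix.one_mul, Matrix.mul_one]
    _ = H * (G * A * H) * G := by simp only [Matrix.mul_assoc]

end
end
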